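/- Let (Ω, 𝒜, ℙ) be a probability space and let S, T : Ω → Ω be commuting measure-preserving maps. Suppose g : Ω → ℝ is measurable, there exists λ > 1 with λ⁻¹ ≤ g ≤ λ ℙ-a.e., and 𝔼(g | 𝒜₁) = 𝔼(g | 𝒜₂) = 1 ℙ-a.e., where 𝒜₁, 𝒜₂ are the sub-σ-algebras of S-invariant and T-invariant sets. Then there exists ε₀ = ε₀(λ) > 0 such that for every ε with 0 < ε ≤ ε₀ there exists n₀ such that for every n ≥ n₀ there is a measurable set ℰ_n with ℙ(ℰ_n) ≤ 2ε² such that for every ω ∉ ℰ_n there exists a matrix A_n(ω) = (a_{ij}(ω)) ∈ n·Ω_n with (2λ)⁻¹ ≤ a_{ij}(ω) ≤ 2λ for all i, j and (1/n²) ∑_{0≤i,j≤n−1} |g(S^i(T^j(ω))) − a_{ij}(ω)| ≤ 16ελ². -/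

import Mathlib

open MeasureTheory Filter

noncomputable section

/-- The sub-σ-algebra of `S`-invariant (measurable) sets. -/
def invSigma {Ω : Type*} [MeasurableSpace Ω] (S : Ω → Ω) : MeasurableSpace Ω where
  MeasurableSet' A := MeasurableSet A ∧ S ⁻¹' A = A
  measurableSet_empty := ⟨MeasurableSet.empty, rfl⟩
  measurableSet_compl A hA := ⟨hA.1.compl, by rw [Set.preimage_compl, hA.2]⟩
  measurableSet_iUnion f hf := ⟨MeasurableSet.iUnion fun i => (hf i).1, by
    rw [Set.preimage_iUnion]
    exact Set.iUnion_congr fun i => (hf i).2⟩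

theorem invSigma_le {Ω : Type*} [m : MeasurableSpace Ω] (T : Ω → Ω) : invSigma T ≤ m :=
  fun _ h => h.1

/-- A function measurable with respect to the invariant σ-algebra is invariant. -/
theorem comp_eq_of_measurable_invSigma {Ω X : Type*} [MeasurableSpace Ω] [MeasurableSpace X]
    [MeasurableSingletonClass X] {T : Ω → Ω} {f : Ω → X} (hf : Measurable[invSigma T] f) :
    f ∘ T = f := by
  funext x
  have h : T ⁻¹' (f ⁻¹' {f x}) = f ⁻¹' {f x} := (hf (measurableSet_singleton (f x))).2
  exact (Set.ext_iff.1 h x).2 rfl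

theorem measurable_invSigma {Ω X : Type*} [MeasurableSpace Ω] [MeasurableSpace X]
    {T : Ω → Ω} {f : Ω → X} (hf : Measurable f) (h : f ∘ T = f) : Measurable[invSigma T] f :=
  fun s hs => ⟨hf hs, by rw [← Set.preimage_comp, h]⟩

/-- An almost everywhere invariant real function agrees almost everywhere with a function that is
measurable with respect to the invariant σ-algebra. -/
theorem aestronglyMeasurable_invSigma {Ω : Type*} [MeasurableSpace Ω] {μ : Measure Ω}
    {T : Ω → Ω} (hT : MeasurePreserving T μ μ) {f : Ω → ℝ} (hf : AEStronglyMeasurable f μ)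
    (h : f ∘ T =ᵐ[μ] f) : AEStronglyMeasurable[invSigma T] f μ := by
  obtain ⟨f', hf'm, hff'⟩ := hf
  have hf'T : f' ∘ T =ᵐ[μ] f' :=
    ((hT.quasiMeasurePreserving.ae_eq_comp hff').symm.trans h).trans hff'
  have hiter : ∀ n : ℕ, f' ∘ T^[n] =ᵐ[μ] f' := fun n => by
    induction n with
    | zero => rfl
    | succ n ih =>
      rw [Function.iterate_succ, ← Function.comp_assoc]
      exact (hT.quasiMeasurePreserving.ae_eq_comp ih).trans hf'T
  refine ⟨fun x => limsup (fun n : ℕ => f' (T^[n] x)) atTop, ?_, ?_⟩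
  · refine (measurable_invSigma ?_ ?_).stronglyMeasurable
    · exact Measurable.limsup fun n => hf'm.measurable.comp (hT.measurable.iterate n)
    · funext x
      exact limsup_nat_add (fun n : ℕ => f' (T^[n] x)) 1
  · filter_upwards [hff', ae_all_iff.2 hiter] with x hx hx'
    have : (fun n : ℕ => f' (T^[n] x)) = fun _ => f' x := funext hx'
    rw [hx, this, limsup_const]

/-- **Mean ergodic theorem** for a measure preserving map: the Birkhoff averages of a square
integrable function converge in `L²` to its conditional expectation on the invariant
σ-algebra. -/
theorem tendsto_eLpNorm_birkhoffAverage_sub_condExp {Ω : Type*} [MeasurableSpace Ω]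
    {μ : Measure Ω} [IsFiniteMeasure μ] {T : Ω → Ω} (hT : MeasurePreserving T μ μ)
    {f : Ω → ℝ} (hf : MemLp f 2 μ) :
    Tendsto (fun n => eLpNorm (birkhoffAverage ℝ T f n - μ[f | invSigma T]) 2 μ) atTop
      (nhds 0) := by
  have hm := invSigma_le T
  set c := μ[f | invSigma T] with hc
  have hcLp : MemLp c 2 μ := hf.condExp (by norm_num)
  have hfi : Integrable f μ := hf.integrable (by norm_num)
  let U := (Lp.compMeasurePreservingₗᵢ ℝ T hT : Lp ℝ 2 μ →ₗᵢ[ℝ] Lp ℝ 2 μ).toContinuousLinearMap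
  have hU : ‖U‖ ≤ 1 := LinearIsometry.norm_toContinuousLinearMap_le _
  have hUc : ∀ u : Lp ℝ 2 μ, U u =ᵐ[μ] u ∘ T := fun u => Lp.coeFn_compMeasurePreserving u hT
  have hproj : ((U.eqLocus (1 : Lp ℝ 2 μ →L[ℝ] Lp ℝ 2 μ)).orthogonalProjectionOnto
      (hf.toLp f) : Lp ℝ 2 μ) = hcLp.toLp c := by
    refine Submodule.eq_starProjection_of_mem_of_inner_eq_zero ?_ ?_
    · change U (hcLp.toLp c) = hcLp.toLp c
      apply Lp.ext
      have hcT : c ∘ T = c :=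
        comp_eq_of_measurable_invSigma stronglyMeasurable_condExp.measurable
      have h := hT.quasiMeasurePreserving.ae_eq_comp hcLp.coeFn_toLp
      rw [hcT] at h
      exact ((hUc _).trans h).trans hcLp.coeFn_toLp.symm
    · intro w hw
      have hwT : w ∘ T =ᵐ[μ] w := by
        have hw' : U w = w := hw
        have := hUc w
        rw [hw'] at this
        exact this.symm
      have hwm := aestronglyMeasurable_invSigma hT (Lp.aestronglyMeasurable w) hwT
      have hfw : Integrable (f * ⇑w) μ := hf.integrable_mul (Lp.memLp w)
      have hcw : Integrable (c * ⇑w) μ := hcLp.integrable_mul (Lp.memLp w)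
      have hint : ∫ x, (f * ⇑w) x ∂μ = ∫ x, (c * ⇑w) x ∂μ := by
        rw [← integral_condExp hm]
        exact integral_congr_ae (condExp_mul_of_aestronglyMeasurable_right hwm hfw hfi)
      rw [← MemLp.toLp_sub, L2.inner_def]
      calc ∫ x, inner ℝ (((hf.sub hcLp).toLp (f - c) : Lp ℝ 2 μ) x) (w x) ∂μ
          = ∫ x, ((f * ⇑w) x - (c * ⇑w) x) ∂μ := by
            refine integral_congr_ae ?_
            filter_upwards [(hf.sub hcLp).coeFn_toLp] with x hx
            simp [hx]
            ring
        _ = 0 := by rw [integral_sub hfw hcw, hint, sub_self]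
  have hiter : ∀ n : ℕ, U^[n] (hf.toLp f) =ᵐ[μ] f ∘ T^[n] := fun n => by
    induction n with
    | zero => exact hf.coeFn_toLp
    | succ n ih =>
      rw [Function.iterate_succ_apply', Function.iterate_succ, ← Function.comp_assoc]
      exact (hUc _).trans (hT.quasiMeasurePreserving.ae_eq_comp ih)
  have hlim := U.tendsto_birkhoffAverage_orthogonalProjection hU (hf.toLp f)
  rw [hproj, ← tendsto_sub_nhds_zero_iff, tendsto_zero_iff_norm_tendsto_zero] at hlim
  have hlim' := ENNReal.tendsto_ofReal hlim
  rw [ENNReal.ofReal_zero] at hlim'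
  refine hlim'.congr fun n => ?_
  rw [Lp.norm_def, ENNReal.ofReal_toReal (Lp.eLpNorm_ne_top _)]
  refine eLpNorm_congr_ae ((Lp.coeFn_sub _ _).trans (EventuallyEq.sub ?_ hcLp.coeFn_toLp))
  have hsum : ⇑(birkhoffSum U _root_.id n (hf.toLp f)) =ᵐ[μ] birkhoffSum T f n := by
    induction n with
    | zero => exact Lp.coeFn_zero _ _ _
    | succ n ih =>
      rw [birkhoffSum_succ]
      filter_upwards [Lp.coeFn_add (birkhoffSum U _root_.id n (hf.toLp f)) (U^[n] (hf.toLp f)),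
        ih, hiter n] with x h₁ h₂ h₃
      rw [birkhoffSum_succ]
      exact h₁.trans (congrArg₂ _ h₂ h₃)
  exact (Lp.coeFn_smul _ _).trans (hsum.const_smul _)

/-- If the Birkhoff averages of `f` along `T` converge to `1` in `L²`, then for large `n` and
outside a set of small measure, most of the `T`-Birkhoff sums of length `n` started from the first
`n` points of an `S`-orbit are close to `n`. -/
theorem exists_measurableSet_sum_abs_birkhoffSum_sub_le {Ω : Type*} [MeasurableSpace Ω]
    {P : Measure Ω} [IsProbabilityMeasure P] {S T : Ω → Ω} (hS : MeasurePreserving S P P)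
    (hT : Measurable T) {f : Ω → ℝ} (hf : Measurable f)
    (hlim : Tendsto (fun n => eLpNorm (birkhoffAverage ℝ T f n - fun _ => 1) 2 P) atTop (nhds 0))
    {δ : ℝ} (hδ : 0 < δ) :
    ∃ n₀ : ℕ, ∀ n : ℕ, n₀ ≤ n → ∃ E : Set Ω, MeasurableSet E ∧ P E ≤ ENNReal.ofReal δ ∧
      ∀ ω ∉ E, ∑ i : Fin n, |birkhoffSum T f n (S^[(i : ℕ)] ω) - n| ≤ δ * (n : ℝ) ^ 2 := by
  have hev := hlim.eventually_le_const (ENNReal.ofReal_pos.2 (pow_pos hδ 2))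
  obtain ⟨n₀, hn₀⟩ := eventually_atTop.1 (hev.and (eventually_ge_atTop 1))
  refine ⟨n₀, fun n hn => ?_⟩
  obtain ⟨hnorm, hn1⟩ := hn₀ n hn
  have hn' : (0 : ℝ) < n := Nat.cast_pos.2 hn1
  set b : Ω → ℝ := birkhoffAverage ℝ T f n - fun _ => 1 with hb
  have hbm : Measurable b := by
    refine Measurable.sub ?_ measurable_const
    have hsum : Measurable (birkhoffSum T f n) :=
      Finset.measurable_fun_sum _ fun i _ => hf.comp (hT.iterate i)
    exact hsum.const_smul (n : ℝ)⁻¹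
  have hbs : ∀ i : ℕ, Measurable fun ω => ‖b (S^[i] ω)‖ₑ := fun i =>
    (hbm.comp (hS.measurable.iterate i)).enorm
  have hFm : Measurable fun ω => ∑ i : Fin n, ‖b (S^[(i : ℕ)] ω)‖ₑ :=
    Finset.measurable_fun_sum _ fun i _ => hbs i
  have hint : ∫⁻ ω, ∑ i : Fin n, ‖b (S^[(i : ℕ)] ω)‖ₑ ∂P ≤ n * ENNReal.ofReal (δ ^ 2) := by
    rw [lintegral_finsetSum _ fun (i : Fin n) _ => hbs i]
    calc _ ≤ ∑ i : Fin n, ENNReal.ofReal (δ ^ 2) := by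
          refine Finset.sum_le_sum fun i _ => ?_
          rw [(hS.iterate i).lintegral_comp hbm.enorm, ← eLpNorm_one_eq_lintegral_enorm]
          exact (eLpNorm_le_eLpNorm_of_exponent_le (by norm_num)
            hbm.aestronglyMeasurable).trans hnorm
      _ = _ := by simp
  refine ⟨{ω | ENNReal.ofReal (n * δ) ≤ ∑ i : Fin n, ‖b (S^[(i : ℕ)] ω)‖ₑ},
    measurableSet_le measurable_const hFm, ?_, fun ω hω => ?_⟩
  · have hmarkov := (mul_meas_ge_le_lintegral (μ := P) hFm (ENNReal.ofReal (n * δ))).trans hint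
    have hpos : 0 < ENNReal.ofReal (n * δ) := ENNReal.ofReal_pos.2 (by positivity)
    refine (ENNReal.mul_le_mul_iff_right hpos.ne' ENNReal.ofReal_ne_top).1 (hmarkov.trans_eq ?_)
    rw [← ENNReal.ofReal_natCast, ← ENNReal.ofReal_mul hn'.le, ← ENNReal.ofReal_mul (by positivity)]
    ring_nf
  · have h : ∑ i : Fin n, |b (S^[(i : ℕ)] ω)| ≤ n * δ := by
      have h' : ∑ i : Fin n, ‖b (S^[(i : ℕ)] ω)‖ₑ < ENNReal.ofReal (n * δ) := not_le.1 hω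
      simp only [← ofReal_norm, Real.norm_eq_abs] at h'
      rw [← ENNReal.ofReal_sum_of_nonneg fun i _ => abs_nonneg _] at h'
      exact ((ENNReal.ofReal_lt_ofReal_iff (by positivity)).1 h').le
    have hscale : ∀ x, |birkhoffSum T f n x - n| = n * |b x| := fun x => by
      rw [← abs_of_pos hn', ← abs_mul, abs_of_pos hn']
      congr 1
      simp only [hb, Pi.sub_apply, birkhoffAverage, smul_eq_mul]
      field_simp
    simp only [hscale, ← Finset.mul_sum]
    calc _ ≤ n * (n * δ) := by gcongr
      _ = _ := by ring

open Finset in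
/-- A square matrix all of whose row and column sums are within `κ * n` of `n` can be made to have
all row and column sums equal to `n` by changing each entry by at most `3 * κ`. -/
theorem exists_sum_eq_of_abs_sum_sub_le {n : ℕ} (hn : 0 < n) {κ : ℝ}
    (G : Matrix (Fin n) (Fin n) ℝ) (hrow : ∀ i, |∑ j, G i j - n| ≤ κ * n)
    (hcol : ∀ j, |∑ i, G i j - n| ≤ κ * n) :
    ∃ A : Matrix (Fin n) (Fin n) ℝ, (∀ i, ∑ j, A i j = n) ∧ (∀ j, ∑ i, A i j = n) ∧
      ∀ i j, |G i j - A i j| ≤ 3 * κ := by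
  have hn' : (0 : ℝ) < n := Nat.cast_pos.2 hn
  set r : Fin n → ℝ := fun i => (∑ j, G i j - n) / n with hr
  set c : Fin n → ℝ := fun j => (∑ i, G i j - n) / n with hc
  set s : ℝ := (∑ i, r i) / n with hs
  have hs' : s = (∑ j, c j) / n := by
    simp only [hs, hr, hc, ← sum_div, sum_sub_distrib]
    rw [sum_comm]
  have hrb : ∀ i, |r i| ≤ κ := fun i => by
    rw [hr, abs_div, abs_of_pos hn', div_le_iff₀ hn']
    exact hrow i
  have hcb : ∀ j, |c j| ≤ κ := fun j => by
    rw [hc, abs_div, abs_of_pos hn', div_le_iff₀ hn']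
    exact hcol j
  have hsb : |s| ≤ κ := by
    rw [hs, abs_div, abs_of_pos hn', div_le_iff₀ hn']
    refine (abs_sum_le_sum_abs _ _).trans ((sum_le_sum fun i _ => hrb i).trans_eq ?_)
    simp [mul_comm]
  refine ⟨fun i j => G i j - r i - c j + s, fun i => ?_, fun j => ?_, fun i j => ?_⟩
  · simp only [sum_add_distrib, sum_sub_distrib, sum_const, card_univ, Fintype.card_fin,
      nsmul_eq_mul]
    rw [hs']
    simp only [hr]
    field_simp
    ring
  · simp only [sum_add_distrib, sum_sub_distrib, sum_const, card_univ, Fintype.card_fin,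
      nsmul_eq_mul]
    rw [hs]
    simp only [hc]
    field_simp
    ring
  · have h₁ := abs_le.1 (hrb i)
    have h₂ := abs_le.1 (hcb j)
    have h₃ := abs_le.1 hsb
    rw [abs_le]
    constructor <;> linarith

open Finset in
theorem card_filter_lt_mul_le {ι : Type*} [Fintype ι] {f : ι → ℝ} (hf : ∀ i, 0 ≤ f i) {a : ℝ} :
    #{i | a < f i} * a ≤ ∑ i, f i := by
  rw [← nsmul_eq_mul]
  exact (card_nsmul_le_sum _ _ _ fun i hi => (mem_filter.1 hi).2.le).trans
    (sum_le_univ_sum_of_nonneg hf)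

open Finset in
/-- Replacing by `1` the entries of a matrix in the rows `R` and the columns `C` yields row sums
close to `n` if `C` is small and the rows outside `R` have sum close to `n`. -/
theorem abs_sum_ite_one_sub_le {n : ℕ} {lam η : ℝ} (hlam : 1 < lam) (hη : 0 < η)
    (G : Matrix (Fin n) (Fin n) ℝ) (hG : ∀ i j, lam⁻¹ ≤ G i j ∧ G i j ≤ lam)
    (R C : Finset (Fin n)) (hR : ∀ i ∉ R, |∑ j, G i j - n| ≤ η * n) (hC : (#C : ℝ) ≤ η * n)
    (i : Fin n) :
    |∑ j, (if i ∈ R ∨ j ∈ C then 1 else G i j) - n| ≤ (1 + lam) * η * n := by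
  by_cases hi : i ∈ R
  · simp only [hi, true_or, if_true, sum_const, card_univ, Fintype.card_fin, nsmul_eq_mul, mul_one,
      sub_self, abs_zero]
    positivity
  · have hsplit : ∑ j, (if i ∈ R ∨ j ∈ C then 1 else G i j) =
        ∑ j, G i j + ∑ j ∈ C, (1 - G i j) := by
      have h : ∑ j ∈ C, (1 - G i j) = ∑ j, if j ∈ C then 1 - G i j else 0 := by simp
      rw [h, ← sum_add_distrib]
      refine sum_congr rfl fun j _ => ?_
      by_cases hj : j ∈ C <;> simp [hi, hj]
    have hCsum : |∑ j ∈ C, (1 - G i j)| ≤ lam * (η * n) := by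
      refine (abs_sum_le_sum_abs _ _).trans ((sum_le_card_nsmul _ _ lam fun j _ => ?_).trans ?_)
      · have := hG i j
        have := inv_pos.2 (zero_lt_one.trans hlam)
        rw [abs_le]
        constructor <;> linarith
      · rw [nsmul_eq_mul, mul_comm]
        gcongr
    rw [hsplit]
    have := abs_add_le (∑ j, G i j - n) (∑ j ∈ C, (1 - G i j))
    have := hR i hi
    calc |∑ j, G i j + ∑ j ∈ C, (1 - G i j) - n|
        = |(∑ j, G i j - n) + ∑ j ∈ C, (1 - G i j)| := by ring_nf
      _ ≤ _ := by linarith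

open Finset in
/-- A matrix with entries in `[lam⁻¹, lam]` whose row sums and column sums are on average close
to `n` is close in `L¹` to one with all row and column sums equal to `n`. -/
theorem exists_scaled_doubly_stochastic_near {n : ℕ} (hn : 0 < n) {lam η : ℝ} (hlam : 1 < lam)
    (hη : 0 < η) (hη' : η ≤ 1 / (12 * lam ^ 2)) (G : Matrix (Fin n) (Fin n) ℝ)
    (hG : ∀ i j, lam⁻¹ ≤ G i j ∧ G i j ≤ lam)
    (hrow : ∑ i, |∑ j, G i j - n| ≤ η ^ 2 * n ^ 2)
    (hcol : ∑ j, |∑ i, G i j - n| ≤ η ^ 2 * n ^ 2) :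
    ∃ A : Matrix (Fin n) (Fin n) ℝ,
      (∀ i j, (2 * lam)⁻¹ ≤ A i j ∧ A i j ≤ 2 * lam) ∧
      (∀ i, ∑ j, A i j = n) ∧ (∀ j, ∑ i, A i j = n) ∧
      (1 / (n : ℝ) ^ 2) * ∑ i, ∑ j, |G i j - A i j| ≤ 16 * η * lam ^ 2 := by
  have hn' : (0 : ℝ) < n := Nat.cast_pos.2 hn
  have hlam0 : 0 < lam := zero_lt_one.trans hlam
  have hinv : lam⁻¹ < 1 := inv_lt_one_of_one_lt₀ hlam
  have hinv0 : 0 < lam⁻¹ := inv_pos.2 hlam0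
  set R : Finset (Fin n) := {i | η * n < |∑ j, G i j - n|} with hRdef
  set C : Finset (Fin n) := {j | η * n < |∑ i, G i j - n|} with hCdef
  have hηn : 0 < η * n := by positivity
  have hRcard : (#R : ℝ) ≤ η * n := by
    refine le_of_mul_le_mul_right ?_ hηn
    exact (card_filter_lt_mul_le fun i => abs_nonneg _).trans (hrow.trans_eq (by ring))
  have hCcard : (#C : ℝ) ≤ η * n := by
    refine le_of_mul_le_mul_right ?_ hηn
    exact (card_filter_lt_mul_le fun i => abs_nonneg _).trans (hcol.trans_eq (by ring))
  let G' : Matrix (Fin n) (Fin n) ℝ := fun i j => if i ∈ R ∨ j ∈ C then 1 else G i j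
  have hG'row : ∀ i, |∑ j, G' i j - n| ≤ (1 + lam) * η * n :=
    abs_sum_ite_one_sub_le hlam hη G hG R C (fun i hi => by simpa [hRdef] using hi) hCcard
  have hG'col : ∀ j, |∑ i, G' i j - n| ≤ (1 + lam) * η * n := fun j => by
    simpa only [G', or_comm, Matrix.transpose_apply] using
      abs_sum_ite_one_sub_le hlam hη G.transpose (fun i j => hG j i) C R
        (fun i hi => by simpa [hCdef] using hi) hRcard j
  obtain ⟨A, hArow, hAcol, hA⟩ := exists_sum_eq_of_abs_sum_sub_le hn G' hG'row hG'col
  have hG'b : ∀ i j, lam⁻¹ ≤ G' i j ∧ G' i j ≤ lam := fun i j => by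
    by_cases h : i ∈ R ∨ j ∈ C
    · simp only [G', if_pos h]
      exact ⟨hinv.le, hlam.le⟩
    · simp only [G', if_neg h]
      exact hG i j
  have hκ : 3 * ((1 + lam) * η) ≤ (2 * lam)⁻¹ := by
    have h₁ : 12 * lam ^ 2 * η ≤ 1 := by
      rwa [le_div_iff₀ (by positivity), mul_comm] at hη'
    rw [← one_div, le_div_iff₀ (by positivity)]
    nlinarith [mul_pos hlam0 hη, mul_pos (mul_pos (sub_pos.2 hlam) hlam0) hη]
  have hhalf : (2 * lam)⁻¹ = lam⁻¹ / 2 := by rw [mul_inv]; ring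
  refine ⟨A, fun i j => ?_, hArow, hAcol, ?_⟩
  · have h₁ := abs_le.1 (hA i j)
    have h₂ := hG'b i j
    constructor <;> linarith
  · have hent : ∀ i j, |G i j - A i j| ≤
        lam * ((if i ∈ R then 1 else 0) + if j ∈ C then 1 else 0) + 3 * ((1 + lam) * η) := by
      intro i j
      refine (abs_sub_le _ (G' i j) _).trans (add_le_add ?_ (hA i j))
      have h₁ : |G i j - 1| ≤ lam := by
        have := hG i j
        rw [abs_le]
        constructor <;> linarith
      by_cases hi : i ∈ R <;> by_cases hj : j ∈ C <;> simp [G', hi, hj] <;> linarith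
    have hsum : ∑ i, ∑ j, |G i j - A i j| ≤
        lam * (n * #R + n * #C) + n * (n * (3 * ((1 + lam) * η))) := by
      refine (sum_le_sum fun i _ => sum_le_sum fun j _ => hent i j).trans_eq ?_
      simp only [sum_add_distrib, ← mul_sum, sum_const, card_univ, Fintype.card_fin, nsmul_eq_mul,
        sum_ite_mem, univ_inter, mul_one]
      ring
    have hfin : lam * (n * #R + n * #C) + n * (n * (3 * ((1 + lam) * η))) ≤
        16 * η * lam ^ 2 * n ^ 2 := by
      calc _ ≤ lam * (n * (η * n) + n * (η * n)) + n * (n * (3 * ((1 + lam) * η))) := by gcongr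
        _ = (5 * lam + 3) * (η * n ^ 2) := by ring
        _ ≤ (16 * lam ^ 2) * (η * n ^ 2) := by
          gcongr
          nlinarith
        _ = _ := by ring
    rw [one_div_mul_eq_div, div_le_iff₀ (by positivity)]
    exact hsum.trans hfin

/-- outside a small exceptional set, `□_n g(ω)` is `L¹`-close to a matrix in
`n·Ω_n` with entries in `[(2λ)⁻¹, 2λ]`. -/
theorem approx_box_by_scaled_doubly_stochastic
    {Ω : Type*} [MeasurableSpace Ω] (P : Measure Ω) [IsProbabilityMeasure P]
    (S T : Ω → Ω) (hS : MeasurePreserving S P P) (hT : MeasurePreserving T P P)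
    (hST : S ∘ T = T ∘ S)
    (g : Ω → ℝ) (hg : Measurable g)
    (lam : ℝ) (hlam : 1 < lam) (hbd : ∀ᵐ ω ∂P, lam⁻¹ ≤ g ω ∧ g ω ≤ lam)
    (hds1 : P[g | invSigma S] =ᵐ[P] fun _ => 1)
    (hds2 : P[g | invSigma T] =ᵐ[P] fun _ => 1) :
    ∃ ε₀ : ℝ, 0 < ε₀ ∧ ∀ ε : ℝ, 0 < ε → ε ≤ ε₀ →
      ∃ n₀ : ℕ, ∀ n : ℕ, n₀ ≤ n →
        ∃ E : Set Ω, MeasurableSet E ∧ P E ≤ ENNReal.ofReal (2 * ε ^ 2) ∧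
          ∀ ω, ω ∉ E →
            ∃ A : Matrix (Fin n) (Fin n) ℝ,
              (∀ i j, (2 * lam)⁻¹ ≤ A i j ∧ A i j ≤ 2 * lam) ∧
              (∀ i, ∑ j, A i j = n) ∧ (∀ j, ∑ i, A i j = n) ∧
              (1 / (n : ℝ) ^ 2) *
                  ∑ i : Fin n, ∑ j : Fin n, |g (S^[(i : ℕ)] (T^[(j : ℕ)] ω)) - A i j|
                ≤ 16 * ε * lam ^ 2 := by
  have hlam0 : 0 < lam := zero_lt_one.trans hlam
  have hgLp : MemLp g 2 P := by
    refine MemLp.of_bound hg.aestronglyMeasurable lam ?_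
    filter_upwards [hbd] with ω hω
    have := inv_pos.2 hlam0
    rw [Real.norm_eq_abs, abs_le]
    constructor <;> linarith
  have hlim : ∀ {U : Ω → Ω}, MeasurePreserving U P P → P[g | invSigma U] =ᵐ[P] (fun _ => 1) →
      Tendsto (fun n => eLpNorm (birkhoffAverage ℝ U g n - fun _ => 1) 2 P) atTop (nhds 0) :=
    fun hU h => (tendsto_eLpNorm_birkhoffAverage_sub_condExp hU hgLp).congr fun n =>
      eLpNorm_congr_ae (EventuallyEq.rfl.sub h)
  refine ⟨1 / (12 * lam ^ 2), by positivity, fun ε hε hε' => ?_⟩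
  obtain ⟨n₁, h₁⟩ := exists_measurableSet_sum_abs_birkhoffSum_sub_le hS hT.measurable hg
    (hlim hT hds2) (pow_pos hε 2)
  obtain ⟨n₂, h₂⟩ := exists_measurableSet_sum_abs_birkhoffSum_sub_le hT hS.measurable hg
    (hlim hS hds1) (pow_pos hε 2)
  have horbit : ∀ᵐ ω ∂P, ∀ i j : ℕ, lam⁻¹ ≤ g (S^[i] (T^[j] ω)) ∧ g (S^[i] (T^[j] ω)) ≤ lam :=
    ae_all_iff.2 fun i => ae_all_iff.2 fun j =>
      ((hS.iterate i).comp (hT.iterate j)).quasiMeasurePreserving.ae hbd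
  obtain ⟨N, hNsub, hNm, hN0⟩ := exists_measurable_superset_of_null (ae_iff.1 horbit)
  refine ⟨max 1 (max n₁ n₂), fun n hn => ?_⟩
  simp only [max_le_iff] at hn
  obtain ⟨E₁, hE₁m, hE₁, hE₁'⟩ := h₁ n hn.2.1
  obtain ⟨E₂, hE₂m, hE₂, hE₂'⟩ := h₂ n hn.2.2
  refine ⟨E₁ ∪ E₂ ∪ N, (hE₁m.union hE₂m).union hNm, ?_, fun ω hω => ?_⟩
  · calc P (E₁ ∪ E₂ ∪ N) ≤ P E₁ + P E₂ + P N :=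
          (measure_union_le _ _).trans (add_le_add_left (measure_union_le _ _) _)
      _ ≤ ENNReal.ofReal (ε ^ 2) + ENNReal.ofReal (ε ^ 2) := by
          rw [hN0, add_zero]
          exact add_le_add hE₁ hE₂
      _ = ENNReal.ofReal (2 * ε ^ 2) := by
          rw [← ENNReal.ofReal_add (sq_nonneg ε) (sq_nonneg ε), two_mul]
  · simp only [Set.mem_union, not_or] at hω
    have hωb : ∀ i j : ℕ, lam⁻¹ ≤ g (S^[i] (T^[j] ω)) ∧ g (S^[i] (T^[j] ω)) ≤ lam := by
      by_contra h
      exact hω.2 (hNsub h)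
    have hcomm : Function.Commute S T := fun x => congrFun hST x
    refine exists_scaled_doubly_stochastic_near hn.1 hlam hε hε'
      (fun i j : Fin n => g (S^[(i : ℕ)] (T^[(j : ℕ)] ω))) (fun i j => hωb i j) ?_ ?_
    · refine Eq.trans_le (Finset.sum_congr rfl fun i _ => ?_) (hE₁' ω hω.1.1)
      rw [birkhoffSum, ← Fin.sum_univ_eq_sum_range fun j => g (T^[j] (S^[(i : ℕ)] ω))]
      simp only [(hcomm.iterate_iterate _ _).eq]
    · refine Eq.trans_le (Finset.sum_congr rfl fun j _ => ?_) (hE₂' ω hω.1.2)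
      rw [birkhoffSum, ← Fin.sum_univ_eq_sum_range fun i => g (S^[i] (T^[(j : ℕ)] ω))]
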